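/- Let w(t), t ∈ [0,1], be a standard one-dimensional Brownian motion with law μ₀ on C₀([0,1],ℝ), and for ε > 0 let p_ε(x) = (2πε)^{-1/2} exp(−x²/(2ε)). Then for every bounded continuous functional F on C₀([0,1],ℝ), lim_{ε→0⁺} E[F(w) p_ε(w(1))] = (2π)^{-1/2} E[F(b)], where b is the standard Brownian bridge on [0,1]. Equivalently, the measures p_ε(ω(1)) μ₀(dω) converge weakly, as ε → 0⁺, to (2π)^{-1/2} times the law of the Brownian bridge. -/

import Mathlib

open MeasureTheory ProbabilityTheory Real Filter
open scoped NNReal ENNReal BoundedContinuousFunction Topology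

noncomputable section

instance : MeasurableSpace C(Set.Icc (0 : ℝ) 1, ℝ) := borel _
instance : BorelSpace C(Set.Icc (0 : ℝ) 1, ℝ) := ⟨rfl⟩

/-- The centered Gaussian density on `ℝ` with variance `ε`. -/
def gaussDens1 (ε x : ℝ) : ℝ := (Real.sqrt (2 * π * ε))⁻¹ * Real.exp (-x ^ 2 / (2 * ε))


/-- Finite linear combination of evaluations. -/
def combEval {n : ℕ} (c : Fin n → ℝ) (t : Fin n → Set.Icc (0 : ℝ) 1) :
    C(Set.Icc (0 : ℝ) 1, ℝ) →L[ℝ] ℝ :=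
  ∑ k, c k • ContinuousMap.evalCLM ℝ (t k)

lemma combEval_apply {n : ℕ} (c : Fin n → ℝ) (t : Fin n → Set.Icc (0 : ℝ) 1)
    (f : C(Set.Icc (0 : ℝ) 1, ℝ)) : combEval c t f = ∑ k, c k * f (t k) := by
  simp [combEval]

lemma path_memLp (μ : Measure C(Set.Icc (0 : ℝ) 1, ℝ))
    (hgauss : ∀ ℓ : C(Set.Icc (0 : ℝ) 1, ℝ) →L[ℝ] ℝ, ∃ v : ℝ≥0, μ.map ℓ = gaussianReal 0 v)
    (ℓ : C(Set.Icc (0 : ℝ) 1, ℝ) →L[ℝ] ℝ) : MemLp ℓ 2 μ := by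
  obtain ⟨v, hv⟩ := hgauss ℓ
  suffices MemLp (id ∘ ℓ) 2 μ from this
  rw [← memLp_map_measure_iff (by fun_prop) (by fun_prop), hv]
  exact memLp_id_gaussianReal 2

lemma path_integral_sq (μ : Measure C(Set.Icc (0 : ℝ) 1, ℝ))
    (ℓ : C(Set.Icc (0 : ℝ) 1, ℝ) →L[ℝ] ℝ) (v : ℝ≥0) (hv : μ.map ℓ = gaussianReal 0 v) :
    ∫ f, (ℓ f) ^ 2 ∂μ = v := by
  have h1 : ∫ x, x ^ 2 ∂(μ.map ℓ) = ∫ f, (ℓ f) ^ 2 ∂μ :=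
    integral_map (by fun_prop) (by fun_prop)
  rw [← h1, hv]
  have h2 := variance_id_gaussianReal (μ := 0) (v := v)
  rw [variance_of_integral_eq_zero (by fun_prop) (by simp [integral_id_gaussianReal])] at h2
  simpa using h2

lemma path_charFunDual (μ : Measure C(Set.Icc (0 : ℝ) 1, ℝ))
    (hgauss : ∀ ℓ : C(Set.Icc (0 : ℝ) 1, ℝ) →L[ℝ] ℝ, ∃ v : ℝ≥0, μ.map ℓ = gaussianReal 0 v)
    (ℓ : C(Set.Icc (0 : ℝ) 1, ℝ) →L[ℝ] ℝ) :
    charFunDual μ ℓ = Complex.exp (-((∫ f, (ℓ f) ^ 2 ∂μ : ℝ) : ℂ) / 2) := by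
  obtain ⟨v, hv⟩ := hgauss ℓ
  rw [charFunDual_eq_charFun_map_one, path_integral_sq μ ℓ v hv, hv, charFun_gaussianReal]
  congr 1
  simp
  ring

lemma path_integral_combEval_sq (μ : Measure C(Set.Icc (0 : ℝ) 1, ℝ))
    (hgauss : ∀ ℓ : C(Set.Icc (0 : ℝ) 1, ℝ) →L[ℝ] ℝ, ∃ v : ℝ≥0, μ.map ℓ = gaussianReal 0 v)
    {n : ℕ} (c : Fin n → ℝ) (t : Fin n → Set.Icc (0 : ℝ) 1) :
    ∫ f, (combEval c t f) ^ 2 ∂μ = ∑ i, ∑ j, c i * c j * ∫ f, f (t i) * f (t j) ∂μ := by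
  have hint : ∀ s t : Set.Icc (0 : ℝ) 1, Integrable (fun f => f s * f t) μ := fun s t =>
    (path_memLp μ hgauss (ContinuousMap.evalCLM ℝ s)).integrable_mul
      (path_memLp μ hgauss (ContinuousMap.evalCLM ℝ t))
  have : ∀ f, (combEval c t f) ^ 2 = ∑ i, ∑ j, c i * c j * (f (t i) * f (t j)) := by
    intro f
    rw [combEval_apply, sq, Finset.sum_mul_sum]
    refine Finset.sum_congr rfl fun i _ => Finset.sum_congr rfl fun j _ => by ring
  simp_rw [this]
  rw [integral_finsetSum _ fun i _ => integrable_finsetSum _ fun j _ => (hint _ _).const_mul _]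
  refine Finset.sum_congr rfl fun i _ => ?_
  rw [integral_finsetSum _ fun j _ => (hint _ _).const_mul _]
  refine Finset.sum_congr rfl fun j _ => ?_
  rw [integral_const_mul]

lemma path_measure_ext (μ ν : Measure C(Set.Icc (0 : ℝ) 1, ℝ))
    [IsFiniteMeasure μ] [IsFiniteMeasure ν]
    (h : ∀ (n : ℕ) (c : Fin n → ℝ) (t : Fin n → Set.Icc (0 : ℝ) 1),
      charFunDual μ (combEval c t) = charFunDual ν (combEval c t)) : μ = ν := by
  apply Measure.ext_of_charFunDual
  funext ℓ
  have key : ∀ (ρ : Measure C(Set.Icc (0 : ℝ) 1, ℝ)) [IsFiniteMeasure ρ],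
      Tendsto (fun n : ℕ => charFunDual ρ (combEval (fun k : Fin (n + 1) => ℓ (bernstein n k))
        (fun k => bernstein.z k))) atTop (𝓝 (charFunDual ρ ℓ)) := by
    intro ρ _
    simp_rw [charFunDual_apply]
    refine tendsto_integral_of_dominated_convergence (fun _ => 1) ?_ (integrable_const _) ?_ ?_
    · intro n
      exact Continuous.aestronglyMeasurable (by fun_prop)
    · intro n
      exact ae_of_all _ fun f => (Complex.norm_exp_ofReal_mul_I _).le
    · refine ae_of_all _ fun f => ?_
      have h1 : Tendsto (fun n => ℓ (bernsteinApproximation n f)) atTop (𝓝 (ℓ f)) :=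
        (ℓ.continuous.tendsto f).comp (bernsteinApproximation_uniform f)
      have h2 : ∀ n, combEval (fun k : Fin (n + 1) => ℓ (bernstein n k))
        (fun k => bernstein.z k) f = ℓ (bernsteinApproximation n f) := by
        intro n
        rw [combEval_apply]
        have : bernsteinApproximation n f
            = ∑ k : Fin (n + 1), f (bernstein.z k) • (bernstein n k : C(Set.Icc (0 : ℝ) 1, ℝ)) := by
          ext x
          rw [bernsteinApproximation.apply]
          simp [mul_comm]
        rw [this, map_sum]
        refine Finset.sum_congr rfl fun k _ => ?_
        rw [map_smul, smul_eq_mul, mul_comm]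
      simp_rw [h2]
      have hc : Continuous fun x : ℝ => Complex.exp (x * Complex.I) := by fun_prop
      exact (hc.tendsto _).comp h1
  have k1 := key μ
  simp_rw [h] at k1
  exact tendsto_nhds_unique k1 (key ν)

/-- The path `t ↦ t`. -/
def idPath : C(Set.Icc (0 : ℝ) 1, ℝ) := ⟨fun t => t, by fun_prop⟩

/-- The map `(g, x) ↦ g + x • idPath`. -/
def bridgeMap (p : C(Set.Icc (0 : ℝ) 1, ℝ) × ℝ) : C(Set.Icc (0 : ℝ) 1, ℝ) :=
  p.1 + p.2 • idPath

lemma continuous_bridgeMap : Continuous bridgeMap := by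
  unfold bridgeMap; fun_prop

lemma wiener_eq_map (μ₀ ν : Measure C(Set.Icc (0 : ℝ) 1, ℝ))
    [IsProbabilityMeasure μ₀] [IsProbabilityMeasure ν]
    (hgauss : ∀ ℓ : C(Set.Icc (0 : ℝ) 1, ℝ) →L[ℝ] ℝ, ∃ v : ℝ≥0, μ₀.map ℓ = gaussianReal 0 v)
    (hcov : ∀ s t : Set.Icc (0 : ℝ) 1, ∫ f, f s * f t ∂μ₀ = min (s : ℝ) (t : ℝ))
    (hgauss' : ∀ ℓ : C(Set.Icc (0 : ℝ) 1, ℝ) →L[ℝ] ℝ, ∃ v : ℝ≥0, ν.map ℓ = gaussianReal 0 v)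
    (hcov' : ∀ s t : Set.Icc (0 : ℝ) 1,
      ∫ f, f s * f t ∂ν = min (s : ℝ) (t : ℝ) - (s : ℝ) * (t : ℝ)) :
    μ₀ = (ν.prod (gaussianReal 0 1)).map bridgeMap := by
  have := Measure.isProbabilityMeasure_map (μ := ν.prod (gaussianReal 0 1))
    continuous_bridgeMap.measurable.aemeasurable
  apply path_measure_ext
  intro n c t
  set ℓ := combEval c t with hℓ
  have hR : charFunDual ((ν.prod (gaussianReal 0 1)).map bridgeMap) ℓ
      = charFunDual ν ℓ * charFun (gaussianReal 0 1) (ℓ idPath) := by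
    rw [charFunDual_apply, integral_map continuous_bridgeMap.measurable.aemeasurable
      (Continuous.aestronglyMeasurable (by fun_prop)), charFunDual_apply, charFun_apply_real,
      ← integral_prod_mul]
    congr 1
    funext p
    rw [← Complex.exp_add]
    congr 1
    simp [bridgeMap]
    ring
  rw [hR, path_charFunDual μ₀ hgauss, path_charFunDual ν hgauss', charFun_gaussianReal,
    ← Complex.exp_add]
  have e1 : ∫ f, (ℓ f) ^ 2 ∂μ₀ = ∫ f, (ℓ f) ^ 2 ∂ν + (ℓ idPath) ^ 2 := by
    rw [hℓ, path_integral_combEval_sq μ₀ hgauss, path_integral_combEval_sq ν hgauss',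
      combEval_apply, sq, Finset.sum_mul_sum, ← Finset.sum_add_distrib]
    refine Finset.sum_congr rfl fun i _ => ?_
    rw [← Finset.sum_add_distrib]
    refine Finset.sum_congr rfl fun j _ => ?_
    rw [hcov, hcov']
    simp only [idPath, ContinuousMap.coe_mk]
    ring
  rw [e1]
  congr 1
  push_cast
  ring

lemma gauss_scale (ε : ℝ) (hε : 0 < ε) (G : ℝ → ℝ) :
    ∫ x, G x * gaussDens1 ε x ∂(gaussianReal 0 1)
      = ∫ y, G (√ε * y) * gaussDens1 1 (√ε * y) ∂(gaussianReal 0 1) := by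
  have hs : 0 < √ε := Real.sqrt_pos.2 hε
  rw [integral_gaussianReal_eq_integral_smul one_ne_zero,
    integral_gaussianReal_eq_integral_smul one_ne_zero]
  have h := Measure.integral_comp_mul_left
    (fun x => gaussianPDFReal 0 1 x • (G x * gaussDens1 ε x)) (√ε)
  rw [abs_of_pos (inv_pos.2 hs), smul_eq_mul] at h
  have h' : ∫ x, gaussianPDFReal 0 1 x • (G x * gaussDens1 ε x)
      = √ε * ∫ x, gaussianPDFReal 0 1 (√ε * x) • (G (√ε * x) * gaussDens1 ε (√ε * x)) := by
    rw [h, ← mul_assoc, mul_inv_cancel₀ hs.ne', one_mul]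
  rw [h', ← integral_const_mul]
  congr 1
  funext y
  have e1 : √ε * gaussDens1 ε (√ε * y) = gaussianPDFReal 0 1 y := by
    have : -(√ε * y) ^ 2 / (2 * ε) = -y ^ 2 / 2 := by
      rw [mul_pow, Real.sq_sqrt hε.le]; field_simp
    simp only [gaussDens1, gaussianPDFReal, this]
    rw [Real.sqrt_mul (by positivity)]
    simp
    field_simp
  have e2 : gaussianPDFReal 0 1 (√ε * y) = gaussDens1 1 (√ε * y) := by
    simp [gaussDens1, gaussianPDFReal]
  rw [← e1, e2]
  simp only [smul_eq_mul]
  ring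

lemma continuous_gaussDens1 (ε : ℝ) : Continuous (gaussDens1 ε) := by
  unfold gaussDens1; fun_prop

lemma gaussDens1_nonneg (ε x : ℝ) : 0 ≤ gaussDens1 ε x := by
  unfold gaussDens1; positivity

lemma gaussDens1_le (ε x : ℝ) (hε : 0 < ε) : gaussDens1 ε x ≤ (√(2 * π * ε))⁻¹ := by
  unfold gaussDens1
  refine mul_le_of_le_one_right (by positivity) (Real.exp_le_one_iff.2 ?_)
  rw [neg_div]
  exact neg_nonpos.2 (by positivity)

/-- if `μ₀` is the Wiener measure and `ν` the law of the Brownian bridge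
on `C([0,1],ℝ)`, then for every bounded continuous `F`,
`∫ F(f) p_ε(f(1)) dμ₀(f) → (2π)^{-1/2} ∫ F dν` as `ε → 0⁺`. -/
theorem wiener_density_at_one_tendsto_brownian_bridge
    (μ₀ ν : Measure C(Set.Icc (0 : ℝ) 1, ℝ))
    [IsProbabilityMeasure μ₀] [IsProbabilityMeasure ν]
    -- μ₀ is the Wiener measure : the centered Gaussian measure with covariance min s t,
    -- concentrated on paths started at 0
    (h0 : μ₀ {f | f 0 = 0} = 1)
    (hgauss : ∀ ℓ : C(Set.Icc (0 : ℝ) 1, ℝ) →L[ℝ] ℝ, ∃ v : ℝ≥0, μ₀.map ℓ = gaussianReal 0 v)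
    (hcov : ∀ s t : Set.Icc (0 : ℝ) 1, ∫ f, f s * f t ∂μ₀ = min (s : ℝ) (t : ℝ))
    -- ν is the law of the Brownian bridge : the centered Gaussian measure with
    -- covariance min s t − s t, concentrated on paths started at 0
    (h0' : ν {f | f 0 = 0} = 1)
    (hgauss' : ∀ ℓ : C(Set.Icc (0 : ℝ) 1, ℝ) →L[ℝ] ℝ, ∃ v : ℝ≥0, ν.map ℓ = gaussianReal 0 v)
    (hcov' : ∀ s t : Set.Icc (0 : ℝ) 1,
      ∫ f, f s * f t ∂ν = min (s : ℝ) (t : ℝ) - (s : ℝ) * (t : ℝ)) :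
    ∀ F : C(Set.Icc (0 : ℝ) 1, ℝ) →ᵇ ℝ,
      Tendsto (fun ε : ℝ => ∫ f, F f * gaussDens1 ε (f 1) ∂μ₀) (𝓝[>] 0)
        (𝓝 ((Real.sqrt (2 * π))⁻¹ * ∫ f, F f ∂ν)) := by
  intro F
  have hmap := wiener_eq_map μ₀ ν hgauss hcov hgauss' hcov'
  -- bridge paths vanish at time one
  have hone : ∀ᵐ g ∂ν, g 1 = 0 := by
    have hi : Integrable (fun g : C(Set.Icc (0 : ℝ) 1, ℝ) => g 1 * g 1) ν :=
      (path_memLp ν hgauss' (ContinuousMap.evalCLM ℝ 1)).integrable_mul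
        (path_memLp ν hgauss' (ContinuousMap.evalCLM ℝ 1))
    have h := hcov' 1 1
    simp only [min_self, Set.Icc.coe_one, mul_one, sub_self] at h
    rw [integral_eq_zero_iff_of_nonneg (fun g => mul_self_nonneg _) hi] at h
    filter_upwards [h] with g hg
    exact mul_self_eq_zero.1 hg
  have hone' : ∀ᵐ p ∂(ν.prod (gaussianReal 0 1)), p.1 1 = 0 :=
    Measure.quasiMeasurePreserving_fst.ae hone
  have hFb : ∀ f, ‖F f‖ ≤ ‖F‖ := F.norm_coe_le_norm
  have hbdd : ∀ (a f ε x), 0 < ε → a = F f * gaussDens1 ε x → ‖a‖ ≤ ‖F‖ * (√(2 * π * ε))⁻¹ := by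
    intro a f ε x hε ha
    rw [ha, norm_mul, Real.norm_of_nonneg (gaussDens1_nonneg _ _)]
    exact mul_le_mul (hFb f) (gaussDens1_le _ _ hε) (gaussDens1_nonneg _ _) (norm_nonneg _)
  have hcb := continuous_bridgeMap
  have hcg := continuous_gaussDens1
  have hc1 : ∀ ε, Continuous fun p : C(Set.Icc (0 : ℝ) 1, ℝ) × ℝ =>
      F (bridgeMap p) * gaussDens1 ε p.2 := fun ε =>
    (F.continuous.comp hcb).mul ((hcg ε).comp continuous_snd)
  have hc2 : ∀ ε, Continuous fun p : C(Set.Icc (0 : ℝ) 1, ℝ) × ℝ =>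
      F (bridgeMap (p.1, √ε * p.2)) * gaussDens1 1 (√ε * p.2) := fun ε =>
    (F.continuous.comp (hcb.comp (by fun_prop))).mul ((hcg 1).comp (by fun_prop))
  have heq : ∀ ε > 0, ∫ f, F f * gaussDens1 ε (f 1) ∂μ₀
      = ∫ p, F (bridgeMap (p.1, √ε * p.2)) * gaussDens1 1 (√ε * p.2)
        ∂(ν.prod (gaussianReal 0 1)) := by
    intro ε hε
    have i1 : ∫ f, F f * gaussDens1 ε (f 1) ∂μ₀
        = ∫ p, F (bridgeMap p) * gaussDens1 ε (bridgeMap p 1) ∂(ν.prod (gaussianReal 0 1)) := by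
      conv_lhs => rw [hmap]
      refine integral_map hcb.measurable.aemeasurable (Continuous.aestronglyMeasurable ?_)
      exact F.continuous.mul ((hcg ε).comp (by fun_prop))
    have i2 : ∫ p, F (bridgeMap p) * gaussDens1 ε (bridgeMap p 1) ∂(ν.prod (gaussianReal 0 1))
        = ∫ p, F (bridgeMap p) * gaussDens1 ε p.2 ∂(ν.prod (gaussianReal 0 1)) := by
      refine integral_congr_ae ?_
      filter_upwards [hone'] with p hp
      have : bridgeMap p 1 = p.2 := by simp [bridgeMap, idPath, hp]
      rw [this]
    rw [i1, i2, integral_prod _ ?_, integral_prod _ ?_]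
    · refine integral_congr_ae (ae_of_all _ fun g => ?_)
      exact gauss_scale ε hε fun x => F (bridgeMap (g, x))
    · exact Integrable.of_bound (hc2 ε).aestronglyMeasurable _
        (ae_of_all _ fun p => hbdd _ _ _ _ one_pos rfl)
    · exact Integrable.of_bound (hc1 ε).aestronglyMeasurable _
        (ae_of_all _ fun p => hbdd _ _ _ _ hε rfl)
  have hlim : Tendsto (fun ε : ℝ => ∫ p, F (bridgeMap (p.1, √ε * p.2)) * gaussDens1 1 (√ε * p.2)
        ∂(ν.prod (gaussianReal 0 1))) (𝓝[>] 0)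
      (𝓝 (∫ p, F p.1 * (√(2 * π))⁻¹ ∂(ν.prod (gaussianReal 0 1)))) := by
    refine tendsto_integral_filter_of_dominated_convergence _
      (Eventually.of_forall fun ε => (hc2 ε).aestronglyMeasurable)
      (Eventually.of_forall fun ε => ae_of_all _ fun p => hbdd _ _ _ _ one_pos rfl)
      (integrable_const _) (ae_of_all _ fun p => ?_)
    have hc : Continuous fun ε : ℝ =>
        F (bridgeMap (p.1, √ε * p.2)) * gaussDens1 1 (√ε * p.2) :=
      (F.continuous.comp (hcb.comp (by fun_prop))).mul ((hcg 1).comp (by fun_prop))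
    have := (hc.tendsto 0).mono_left (nhdsWithin_le_nhds (s := Set.Ioi 0))
    simpa [bridgeMap, gaussDens1] using this
  have hfin : ∫ p, F p.1 * (√(2 * π))⁻¹ ∂(ν.prod (gaussianReal 0 1))
      = (√(2 * π))⁻¹ * ∫ f, F f ∂ν := by
    rw [integral_mul_const, mul_comm, integral_fun_fst (f := fun g => F g)]
    simp
  rw [hfin] at hlim
  refine hlim.congr' ?_
  filter_upwards [self_mem_nhdsWithin] with ε hε
  exact (heq ε hε).symm
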